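/- Generator in Stratonovich coefficients. Let E_ll, E_l0, E00 be Stratonovich coefficients on (h, K) with derived SLH triple (S, L, H). Then the generator K₀ := -(1/2)L*L - iH satisfies the identity K₀ = -i·E00 - (1/2)·E_0l∘(I + (i/2)E_ll)⁻¹∘E_l0. -/

import Mathlib

open ContinuousLinearMap

section CStarAlgebra

variable {A : Type*} [CStarAlgebra A] {a : A}

/-- The element `1 + (i/2) a` is invertible for self-adjoint `a`. -/
theorem IsSelfAdjoint.isUnit_one_add_I_div_two_smul (ha : IsSelfAdjoint a) :
    IsUnit (1 + (Complex.I / 2) • a) := by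
  have hmem : (2 * Complex.I) ∉ spectrum ℂ a := fun hs => by
    simpa using ha.im_eq_zero_of_mem_spectrum hs
  have hunit : IsUnit (algebraMap ℂ A (2 * Complex.I) - a) := spectrum.notMem_iff.mp hmem
  have hc : IsUnit (-(Complex.I / 2)) := by simp
  have heq : 1 + (Complex.I / 2) • a =
      (-(Complex.I / 2)) • (algebraMap ℂ A (2 * Complex.I) - a) := by
    have hI : -(Complex.I / 2) * (2 * Complex.I) = 1 := by
      linear_combination -Complex.I_mul_I
    rw [smul_sub, Algebra.algebraMap_eq_smul_one, smul_smul, hI, one_smul, neg_smul,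
      sub_neg_eq_add]
  rw [heq, Algebra.smul_def]
  exact (hc.map (algebraMap ℂ A)).mul hunit

/-- For `r = (1 + (i/2) a)⁻¹` with `a` self-adjoint, `r* r` is the real part of `r`. -/
theorem IsSelfAdjoint.star_mul_inverse_one_add_I_div_two_smul (ha : IsSelfAdjoint a) :
    star (Ring.inverse (1 + (Complex.I / 2) • a)) * Ring.inverse (1 + (Complex.I / 2) • a) =
      (1 / 2 : ℂ) • (Ring.inverse (1 + (Complex.I / 2) • a) +
        star (Ring.inverse (1 + (Complex.I / 2) • a))) := by
  have hu := ha.isUnit_one_add_I_div_two_smul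
  set b := 1 + (Complex.I / 2) • a with hb
  have hright : b * Ring.inverse b = 1 := Ring.mul_inverse_cancel b hu
  have hleft : star (Ring.inverse b) * star b = 1 := by rw [← star_mul, hright, star_one]
  have hsum : b + star b = (2 : ℂ) • (1 : A) := by
    have hI : star (Complex.I / 2) = -(Complex.I / 2) := by simp [neg_div]
    rw [hb, star_add, star_one, star_smul, ha.star_eq, hI]
    module
  have key : star (Ring.inverse b) * (b + star b) * Ring.inverse b =
      Ring.inverse b + star (Ring.inverse b) := by
    rw [mul_add, add_mul, hleft, mul_assoc, hright, mul_one, one_mul, add_comm]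
  rw [← key, hsum, mul_smul_comm, mul_one, smul_mul_assoc, smul_smul]
  norm_num

end CStarAlgebra

/-- **Generator in Stratonovich coefficients.** For Stratonovich
coefficients `(E_ll, E_l0, E00)` with derived SLH triple `(S, L, H)`, the generator
`K₀ = -(1/2)L*L - iH` satisfies `K₀ = -i E00 - (1/2) E_0l (I + (i/2)E_ll)⁻¹ E_l0`. -/
theorem generator_in_stratonovich_coefficients
    {h K : Type*} [NormedAddCommGroup h] [InnerProductSpace ℂ h] [CompleteSpace h]
    [NormedAddCommGroup K] [InnerProductSpace ℂ K] [CompleteSpace K]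
    (Ell : K →L[ℂ] K) (El0 : h →L[ℂ] K) (E00 : h →L[ℂ] h)
    (hEll : IsSelfAdjoint Ell) (hE00 : IsSelfAdjoint E00)
    (L : h →L[ℂ] K)
    (hL : L = Complex.I •
        (Ring.inverse ((1 : K →L[ℂ] K) + (Complex.I / 2) • Ell) ∘L El0))
    (H : h →L[ℂ] h)
    (hH : H = E00 + (1/2 : ℂ) • ((2 * Complex.I)⁻¹ •
        ((adjoint El0 ∘L Ring.inverse ((1 : K →L[ℂ] K) + (Complex.I / 2) • Ell) ∘L El0) -
          adjoint (adjoint El0 ∘L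
            Ring.inverse ((1 : K →L[ℂ] K) + (Complex.I / 2) • Ell) ∘L El0)))) :
    -((1/2 : ℂ) • (adjoint L ∘L L)) - Complex.I • H
      = -(Complex.I • E00) - (1/2 : ℂ) •
          (adjoint El0 ∘L Ring.inverse ((1 : K →L[ℂ] K) + (Complex.I / 2) • Ell) ∘L El0) := by
  have hR := hEll.star_mul_inverse_one_add_I_div_two_smul
  set R := Ring.inverse ((1 : K →L[ℂ] K) + (Complex.I / 2) • Ell)
  have hadj : adjoint (adjoint El0 ∘L R ∘L El0) = adjoint El0 ∘L star R ∘L El0 := by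
    simp only [adjoint_comp, adjoint_adjoint, star_eq_adjoint, comp_assoc]
  have hLL : adjoint L ∘L L = (1 / 2 : ℂ) •
      (adjoint El0 ∘L R ∘L El0 + adjoint El0 ∘L star R ∘L El0) := by
    have hcomp : adjoint L ∘L L = adjoint El0 ∘L (star R * R) ∘L El0 := by
      have hL_adj : adjoint L = -(Complex.I • (adjoint El0 ∘L star R)) := by
        rw [hL, map_smulₛₗ, adjoint_comp, star_eq_adjoint, Complex.conj_I, neg_smul]
      ext x
      rw [hL_adj, hL]
      simp [smul_smul]
    rw [hcomp, hR]
    simp only [smul_comp, comp_smul, add_comp, comp_add]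
  have hI : Complex.I * ((1 / 2) * (2 * Complex.I)⁻¹) = 1 / 4 := by
    field_simp
    norm_num
  rw [hLL, hH, hadj, smul_add Complex.I, smul_smul (1 / 2 : ℂ) (2 * Complex.I)⁻¹,
    smul_smul Complex.I, hI]
  module
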